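/- Let T be a set of sign vectors on Fin 8 such that: T is closed under negation; |T| = 58; S2(8) ⊆ T ⊆ S1(8); and T satisfies the VC condition for rank 3. Then for every T ∈ T, the restriction (T(1),T(2),T(5),T(6)) is none of (1,−1,−1,1), (−1,1,1,−1), (1,−1,1,−1), (−1,1,−1,1). (In the paper's argument: restricting a putative uniform rank-3 factor M′ to {1,…,6} forces (+,−,0,0,−,+,0,0) to be a circuit of M′, while restricting to {1,2,5,6,7,8} forces (+,−,0,0,+,−,0,0) to be a circuit; both perpendicularity conclusions hold for all topes.) -/

import Mathlib

/-- A sign vector on `Fin n`: every entry is `1` or `-1`. -/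
def IsSignVec {n : ℕ} (v : Fin n → ℤ) : Prop := ∀ i, v i = 1 ∨ v i = -1

/-- The number of sign changes of `v`. -/
def signChanges {n : ℕ} (v : Fin n → ℤ) : ℕ :=
  (Finset.univ.filter
    (fun i : Fin (n - 1) =>
      v ⟨i.val, by omega⟩ ≠ v ⟨i.val + 1, by omega⟩)).card

/-- The permutation σ of `{1,…,n}` (on values) swapping `2j-1` and `2j`. -/
def pairSwap (m : ℕ) : ℕ := if m % 2 = 1 then m + 1 else m - 1

/-- The tope `v_k` of the rank-2 oriented matroid `M₂`. -/
def vk (n k : ℕ) : Fin n → ℤ := fun i => if k < pairSwap (i.val + 1) then 1 else -1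

/-- Topes of the rank-2 oriented matroid `M₂` on `n` elements. -/
def S2 (n : ℕ) : Set (Fin n → ℤ) := {v | ∃ k ≤ n, v = vk n k ∨ v = -vk n k}

/-- The VC condition for rank 3. -/
def VCCondition {n : ℕ} (T : Finset (Fin n → ℤ)) : Prop :=
  ∀ Q : Finset (Fin n), Q.card = 4 →
    ∃ c : Fin n → ℤ,
      (∀ i, c i = 1 ∨ c i = 0 ∨ c i = -1) ∧
      (∀ i, c i ≠ 0 ↔ i ∈ Q) ∧
      (∀ t ∈ T, ¬ ∀ i ∈ Q, t i = c i) ∧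
      (∀ t ∈ T, ¬ ∀ i ∈ Q, t i = -c i)

section

open Finset

/-- No `r + 1` coordinates carry a full set of antipodal pairs: for every injective choice of
`r + 1` coordinates some pattern `c` is such that neither `c` nor `-c` is realized by `T`. -/
def MissesAntipodal {n : ℕ} (r : ℕ) (T : Finset (Fin n → ℤ)) : Prop :=
  ∀ q : Fin (r + 1) → Fin n, Function.Injective q →
    ∃ c : Fin (r + 1) → ℤ, IsSignVec c ∧ ∀ t ∈ T, t ∘ q ≠ c ∧ t ∘ q ≠ -c

theorem VCCondition.missesAntipodal {n : ℕ} {T : Finset (Fin n → ℤ)} (h : VCCondition T) :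
    MissesAntipodal 3 T := by
  intro q hq
  obtain ⟨c, hc, hsupp, hpos, hneg⟩ :=
    h (univ.image q) (by rw [card_image_of_injective _ hq]; simp)
  refine ⟨c ∘ q, fun j => ?_, fun t ht => ⟨fun he => hpos t ht ?_, fun he => hneg t ht ?_⟩⟩
  · have := (hsupp (q j)).2 (mem_image_of_mem q (mem_univ j))
    rcases hc (q j) with h | h | h
    · exact Or.inl h
    · exact absurd h this
    · exact Or.inr h
  · simpa using fun j => congrFun he j
  · simpa using fun j => congrFun he j

theorem MissesAntipodal.image_comp {m n r : ℕ} {T : Finset (Fin n → ℤ)}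
    (h : MissesAntipodal r T) {f : Fin m → Fin n} (hf : Function.Injective f) :
    MissesAntipodal r (T.image (· ∘ f)) := by
  intro q hq
  obtain ⟨c, hc, hT⟩ := h (f ∘ q) (hf.comp hq)
  refine ⟨c, hc, fun t ht => ?_⟩
  obtain ⟨s, hs, rfl⟩ := mem_image.1 ht
  exact hT s hs

/-- The vectors both of whose one-coordinate extensions at `p` belong to `T`. -/
def doubleLifts {n : ℕ} (p : Fin (n + 1)) (T : Finset (Fin (n + 1) → ℤ)) : Finset (Fin n → ℤ) :=
  (T.filter (· p = 1)).image (· ∘ p.succAbove) ∩ (T.filter (· p = -1)).image (· ∘ p.succAbove)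

theorem exists_lift_of_mem_doubleLifts {n : ℕ} {p : Fin (n + 1)} {T : Finset (Fin (n + 1) → ℤ)}
    {u : Fin n → ℤ} (hu : u ∈ doubleLifts p T) {e : ℤ} (he : e = 1 ∨ e = -1) :
    ∃ t ∈ T, t p = e ∧ t ∘ p.succAbove = u := by
  simp only [doubleLifts, mem_inter, mem_image, mem_filter] at hu
  obtain ⟨⟨t, ⟨ht, htp⟩, htu⟩, ⟨s, ⟨hs, hsp⟩, hsu⟩⟩ := hu
  rcases he with rfl | rfl
  · exact ⟨t, ht, htp, htu⟩
  · exact ⟨s, hs, hsp, hsu⟩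

theorem card_eq_card_image_add_card_doubleLifts {n : ℕ} (p : Fin (n + 1))
    {T : Finset (Fin (n + 1) → ℤ)} (hT : ∀ t ∈ T, IsSignVec t) :
    T.card = (T.image (· ∘ p.succAbove)).card + (doubleLifts p T).card := by
  have hinj : ∀ e : ℤ,
      Set.InjOn (· ∘ p.succAbove) (T.filter (· p = e) : Set (Fin (n + 1) → ℤ)) := by
    intro e s hs t ht hst
    simp only [coe_filter, Set.mem_ofPred_eq] at hs ht
    funext i
    rcases Fin.eq_self_or_eq_succAbove p i with rfl | ⟨j, rfl⟩
    · rw [hs.2, ht.2]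
    · exact congrFun hst j
  have hunion : T.filter (· p = 1) ∪ T.filter (· p = -1) = T := by
    rw [← filter_or]
    exact filter_true_of_mem fun t ht => hT t ht p
  have hdisj : Disjoint (T.filter (· p = 1)) (T.filter (· p = -1)) :=
    disjoint_filter.2 fun t _ h1 h2 => by omega
  rw [doubleLifts]
  nth_rw 2 [← hunion]
  rw [image_union, card_union_add_card_inter, card_image_of_injOn (hinj 1),
    card_image_of_injOn (hinj (-1)), ← card_union_of_disjoint hdisj, hunion]

theorem MissesAntipodal.doubleLifts {n r : ℕ} {p : Fin (n + 1)} {T : Finset (Fin (n + 1) → ℤ)}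
    (h : MissesAntipodal (r + 1) T) : MissesAntipodal r (doubleLifts p T) := by
  intro q hq
  obtain ⟨c, hc, hT⟩ := h (Fin.cons p (p.succAbove ∘ q))
    (Fin.cons_injective_iff.2 ⟨by rintro ⟨j, hj⟩; exact p.succAbove_ne _ hj,
      Fin.succAbove_right_injective.comp hq⟩)
  refine ⟨Fin.tail c, fun j => hc j.succ, fun u hu => ⟨fun he => ?_, fun he => ?_⟩⟩
  · obtain ⟨t, ht, htp, rfl⟩ := exists_lift_of_mem_doubleLifts hu (hc 0)
    refine (hT t ht).1 (funext fun j => ?_)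
    cases j using Fin.cases with
    | zero => exact htp
    | succ j => exact congrFun he j
  · obtain ⟨t, ht, htp, rfl⟩ := exists_lift_of_mem_doubleLifts hu (e := -c 0)
      (by rcases hc 0 with h | h <;> simp [h])
    refine (hT t ht).2 (funext fun j => ?_)
    cases j using Fin.cases with
    | zero => exact htp
    | succ j => exact congrFun he j

theorem isSignVec_of_mem_image_comp {m n : ℕ} {T : Finset (Fin n → ℤ)}
    (hT : ∀ t ∈ T, IsSignVec t) (f : Fin m → Fin n) :
    ∀ t ∈ T.image (· ∘ f), IsSignVec t := by
  intro t ht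
  obtain ⟨s, hs, rfl⟩ := mem_image.1 ht
  exact fun i => hT s hs (f i)

theorem isSignVec_of_mem_doubleLifts {n : ℕ} {p : Fin (n + 1)} {T : Finset (Fin (n + 1) → ℤ)}
    (hT : ∀ t ∈ T, IsSignVec t) : ∀ t ∈ doubleLifts p T, IsSignVec t := by
  intro u hu
  obtain ⟨t, ht, -, rfl⟩ := exists_lift_of_mem_doubleLifts hu (Or.inl rfl)
  exact fun i => hT t ht _

theorem MissesAntipodal.eq_empty {n : ℕ} {T : Finset (Fin (n + 1) → ℤ)}
    (h : MissesAntipodal 0 T) (hT : ∀ t ∈ T, IsSignVec t) : T = ∅ := by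
  obtain ⟨c, hc, hcT⟩ := h (fun _ => 0) fun i j _ => Fin.ext (by omega)
  refine eq_empty_of_forall_notMem fun t ht => ?_
  obtain ⟨h1, h2⟩ := hcT t ht
  rw [ne_eq, funext_iff] at h1 h2
  simp only [Nat.reduceAdd, Fin.forall_fin_one, Function.comp_apply, Pi.neg_apply] at h1 h2
  have h3 := hc 0
  have h4 := hT t ht 0
  omega

/-- The antipodal Sauer–Shelah bound. -/
theorem MissesAntipodal.card_le {n r : ℕ} {T : Finset (Fin (n + 1) → ℤ)}
    (h : MissesAntipodal r T) (hT : ∀ t ∈ T, IsSignVec t) :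
    T.card ≤ 2 * ∑ k ∈ range r, n.choose k := by
  induction n generalizing r with
  | zero =>
    cases r with
    | zero => simp [h.eq_empty hT]
    | succ r =>
      have hsub : T ⊆ {fun _ => 1, fun _ => -1} := by
        intro t ht
        simpa [funext_iff, Fin.forall_fin_one] using hT t ht 0
      have := (card_le_card hsub).trans card_le_two
      rw [sum_range_succ']
      simp only [Nat.choose_zero_right]
      omega
  | succ n ih =>
    cases r with
    | zero => simp [h.eq_empty hT]
    | succ r =>
      have hp := card_eq_card_image_add_card_doubleLifts 0 hT
      have h1 := ih (h.image_comp (Fin.succAbove_right_injective (p := 0)))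
        (isSignVec_of_mem_image_comp hT _)
      have h2 := ih (h.doubleLifts (p := 0)) (isSignVec_of_mem_doubleLifts hT)
      rw [hp]
      refine (add_le_add h1 h2).trans_eq ?_
      simp only [sum_range_succ', Nat.choose_succ_succ, sum_add_distrib, Nat.choose_zero_right]
      ring

/-- All sign vectors on `Fin n`. -/
def signVecs : (n : ℕ) → List (Fin n → ℤ)
  | 0 => [Fin.elim0]
  | n + 1 => (signVecs n).flatMap fun v => [Fin.cons 1 v, Fin.cons (-1) v]

theorem mem_signVecs {n : ℕ} {v : Fin n → ℤ} (hv : IsSignVec v) : v ∈ signVecs n := by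
  induction n with
  | zero => simp [signVecs, eq_iff_true_of_subsingleton]
  | succ n ih =>
    refine List.mem_flatMap.2 ⟨Fin.tail v, ih fun i => hv i.succ, ?_⟩
    rw [← Fin.cons_self_tail v, Fin.tail_cons]
    rcases hv 0 with h | h <;> simp [h]

/-- Backtracking search: `true` means that no set of at least `need` elements of `cur` contains
`must` and satisfies, for each entry of the list of constraints, one of the predicates offered
there. -/
def refute {α : Type} (need : ℕ) (must : List α) : List (List (α → Bool)) → List α → Bool
  | [], cur => decide (cur.length < need)
  | opts :: rest, cur => opts.all fun keep =>
      !must.all keep || decide ((cur.filter keep).length < need) ||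
        refute need must rest (cur.filter keep)

theorem refute_sound {α : Type} [DecidableEq α] {need : ℕ} {must : List α} {G : Finset α}
    (hneed : need ≤ G.card) (hmust : ∀ x ∈ must, x ∈ G) :
    ∀ (cs : List (List (α → Bool))) (cur : List α), (∀ x ∈ G, x ∈ cur) →
      (∀ opts ∈ cs, ∃ keep ∈ opts, ∀ x ∈ G, keep x = true) → refute need must cs cur ≠ true := by
  have hlen : ∀ cur : List α, (∀ x ∈ G, x ∈ cur) → ¬ cur.length < need := by
    intro cur hcur
    have h1 : G ⊆ cur.toFinset := fun x hx => List.mem_toFinset.2 (hcur x hx)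
    have h2 := (card_le_card h1).trans (List.toFinset_card_le cur)
    omega
  intro cs
  induction cs with
  | nil =>
    intro cur hcur _ h
    exact hlen cur hcur (by simpa [refute] using h)
  | cons opts rest ih =>
    intro cur hcur hcs h
    obtain ⟨keep, hkeep, hG⟩ := hcs opts List.mem_cons_self
    have hcur' : ∀ x ∈ G, x ∈ cur.filter keep := fun x hx =>
      List.mem_filter.2 ⟨hcur x hx, hG x hx⟩
    have hk := List.all_eq_true.1 h keep hkeep
    simp only [Bool.or_eq_true, Bool.not_eq_true', decide_eq_true_eq] at hk
    rcases hk with (hk | hk) | hk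
    · rw [List.all_eq_true.2 fun x hx => hG x (hmust x hx)] at hk
      exact Bool.noConfusion hk
    · exact hlen _ hcur' hk
    · exact ih _ hcur' (fun o ho => hcs o (List.mem_cons_of_mem _ ho)) hk

/-- The four-element subsets of `Fin 6`, in an order that keeps the search small. -/
def quadruples : List (Fin 4 → Fin 6) :=
  [![0, 1, 2, 4], ![0, 1, 3, 5], ![0, 2, 4, 5], ![1, 2, 3, 5], ![1, 3, 4, 5], ![0, 2, 3, 4],
    ![0, 1, 2, 3], ![0, 1, 4, 5], ![0, 3, 4, 5], ![1, 2, 4, 5], ![0, 1, 2, 5], ![0, 1, 3, 4],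
    ![2, 3, 4, 5], ![1, 2, 3, 4], ![0, 2, 3, 5]]

/-- The ways in which the coordinates `q` can miss an antipodal pair of patterns. -/
def avoidances (q : Fin 4 → Fin 6) : List ((Fin 6 → ℤ) → Bool) :=
  (signVecs 3).map fun c t =>
    decide (t ∘ q ≠ Fin.cons 1 c) && decide (t ∘ q ≠ -Fin.cons 1 c)

theorem MissesAntipodal.exists_avoidance {T : Finset (Fin 6 → ℤ)} (h : MissesAntipodal 3 T)
    {q : Fin 4 → Fin 6} (hq : Function.Injective q) :
    ∃ keep ∈ avoidances q, ∀ t ∈ T, keep t = true := by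
  obtain ⟨c, hc, hT⟩ := h q hq
  rcases hc 0 with h0 | h0
  · refine ⟨_, List.mem_map_of_mem (mem_signVecs (v := Fin.tail c) fun i => hc i.succ), ?_⟩
    intro t ht
    rw [← h0, Fin.cons_self_tail]
    simpa using hT t ht
  · refine ⟨_, List.mem_map_of_mem (mem_signVecs (v := Fin.tail (-c)) fun i => ?_), ?_⟩
    · rcases hc i.succ with h | h <;> simp [Fin.tail, h]
    · intro t ht
      have h1 : (1 : ℤ) = (-c) 0 := by simp [h0]
      rw [h1, Fin.cons_self_tail, neg_neg]
      simpa using (hT t ht).symm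

/-- The sign vectors on `Fin 6` with at most three sign changes. -/
def candidates : List (Fin 6 → ℤ) := (signVecs 6).filter fun v => decide (signChanges v ≤ 3)

/-- The topes of the rank-2 oriented matroid on six elements. -/
def lowerTopes : List (Fin 6 → ℤ) :=
  (List.range 7).flatMap fun k => [vk 6 k, -vk 6 k]

theorem refute_outer :
    refute 32 (![1, -1, -1, -1, -1, 1] :: lowerTopes) (quadruples.map avoidances) candidates
      = true := by
  decide +kernel

theorem refute_alternating :
    refute 32 (![1, -1, 1, -1, -1, -1] :: lowerTopes) (quadruples.map avoidances) candidates
      = true := by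
  decide +kernel

/-- The properties of `T` inherited by its restrictions to six coordinates, together with the
maximality of the restriction. -/
structure IsMaximalSix (T : Finset (Fin 6 → ℤ)) : Prop where
  isSignVec : ∀ t ∈ T, IsSignVec t
  signChanges_le : ∀ t ∈ T, signChanges t ≤ 3
  lower : ∀ t ∈ S2 6, t ∈ T
  misses : MissesAntipodal 3 T
  card_ge : 32 ≤ T.card

theorem IsMaximalSix.notMem {T : Finset (Fin 6 → ℤ)} (h : IsMaximalSix T) {t : Fin 6 → ℤ}
    (ht : refute 32 (t :: lowerTopes) (quadruples.map avoidances) candidates = true) :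
    t ∉ T := by
  intro htT
  refine refute_sound h.card_ge ?_ _ _ ?_ ?_ ht
  · intro x hx
    rcases List.mem_cons.1 hx with rfl | hx
    · exact htT
    · obtain ⟨k, hk, hx⟩ := List.mem_flatMap.1 hx
      have hk6 : k ≤ 6 := by simpa [Nat.lt_succ_iff] using hk
      exact h.lower x ⟨k, hk6, by simpa using hx⟩
  · intro x hx
    exact List.mem_filter.2
      ⟨mem_signVecs (h.isSignVec x hx), decide_eq_true (h.signChanges_le x hx)⟩
  · intro opts hopts
    obtain ⟨q, hq, rfl⟩ := List.mem_map.1 hopts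
    have hinj : ∀ q ∈ quadruples, Function.Injective q := by decide +kernel
    exact h.misses.exists_avoidance (hinj q hq)

/-- A candidate with the pattern `(+,-,-,+)` on the outer coordinates is `(+,-,-,-,-,+)`. -/
theorem IsMaximalSix.avoids_outer {T : Finset (Fin 6 → ℤ)} (h : IsMaximalSix T) {t : Fin 6 → ℤ}
    (ht : t ∈ T) : ¬ (t 0 = 1 ∧ t 1 = -1 ∧ t 4 = -1 ∧ t 5 = 1) := by
  have key : ∀ v ∈ candidates, v 0 = 1 ∧ v 1 = -1 ∧ v 4 = -1 ∧ v 5 = 1 →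
      v = ![1, -1, -1, -1, -1, 1] := by decide +kernel
  intro hp
  have := key t (List.mem_filter.2
    ⟨mem_signVecs (h.isSignVec t ht), decide_eq_true (h.signChanges_le t ht)⟩) hp
  exact h.notMem refute_outer (this ▸ ht)

/-- A candidate that starts with `(+,-,+,-)` is `(+,-,+,-,-,-)`. -/
theorem IsMaximalSix.avoids_alternating {T : Finset (Fin 6 → ℤ)} (h : IsMaximalSix T)
    {t : Fin 6 → ℤ} (ht : t ∈ T) : ¬ (t 0 = 1 ∧ t 1 = -1 ∧ t 2 = 1 ∧ t 3 = -1) := by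
  have key : ∀ v ∈ candidates, v 0 = 1 ∧ v 1 = -1 ∧ v 2 = 1 ∧ v 3 = -1 →
      v = ![1, -1, 1, -1, -1, -1] := by decide +kernel
  intro hp
  have := key t (List.mem_filter.2
    ⟨mem_signVecs (h.isSignVec t ht), decide_eq_true (h.signChanges_le t ht)⟩) hp
  exact h.notMem refute_alternating (this ▸ ht)

theorem card_le_card_image_comp_succAbove {n r : ℕ} {T : Finset (Fin (n + 2) → ℤ)}
    (h : MissesAntipodal (r + 1) T) (hT : ∀ t ∈ T, IsSignVec t) (p : Fin (n + 2)) :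
    T.card ≤ (T.image (· ∘ p.succAbove)).card + 2 * ∑ k ∈ range r, n.choose k := by
  rw [card_eq_card_image_add_card_doubleLifts p hT]
  exact Nat.add_le_add_left (h.doubleLifts.card_le (isSignVec_of_mem_doubleLifts hT)) _

/-- Deleting two coordinates from a maximal set on `Fin 8`. -/
theorem isMaximalSix_image {T : Finset (Fin 8 → ℤ)} (hcard : T.card = 58)
    (hlower : ∀ v ∈ S2 8, v ∈ T) (hupper : ∀ v ∈ T, IsSignVec v ∧ signChanges v ≤ 3)
    (hvc : VCCondition T) {f : Fin 6 → Fin 8} (p : Fin 8) (p' : Fin 7)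
    (hf : f = p.succAbove ∘ p'.succAbove)
    (hmono : ∀ v ∈ signVecs 8, signChanges v ≤ 3 → signChanges (v ∘ f) ≤ 3)
    (hvk : ∀ k ∈ range 7, ∃ j ∈ range 9, vk 8 j ∘ f = vk 6 k) :
    IsMaximalSix (T.image (· ∘ f)) := by
  have hT : ∀ t ∈ T, IsSignVec t := fun t ht => (hupper t ht).1
  have hm := hvc.missesAntipodal
  have hinj : Function.Injective f :=
    hf ▸ Fin.succAbove_right_injective.comp Fin.succAbove_right_injective
  refine ⟨isSignVec_of_mem_image_comp hT f, fun t ht => ?_, ?_, hm.image_comp hinj, ?_⟩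
  · obtain ⟨s, hs, rfl⟩ := mem_image.1 ht
    exact hmono s (mem_signVecs (hT s hs)) (hupper s hs).2
  · rintro t ⟨k, hk, ht⟩
    obtain ⟨j, hj, hjk⟩ := hvk k (mem_range.2 (by omega))
    have hj8 : j ≤ 8 := by simpa [Nat.lt_succ_iff] using hj
    rcases ht with rfl | rfl
    · exact mem_image.2 ⟨_, hlower _ ⟨j, hj8, Or.inl rfl⟩, hjk⟩
    · exact mem_image.2 ⟨_, hlower _ ⟨j, hj8, Or.inr rfl⟩, hjk ▸ rfl⟩
  · have h1 : T.card ≤ (T.image (· ∘ p.succAbove)).card + 14 :=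
      card_le_card_image_comp_succAbove hm hT p
    have h2 : (T.image (· ∘ p.succAbove)).card ≤
        ((T.image (· ∘ p.succAbove)).image (· ∘ p'.succAbove)).card + 12 :=
      card_le_card_image_comp_succAbove
        (hm.image_comp Fin.succAbove_right_injective)
        (isSignVec_of_mem_image_comp hT p.succAbove) p'
    have h3 : (T.image (· ∘ p.succAbove)).image (· ∘ p'.succAbove) = T.image (· ∘ f) := by
      rw [image_image, hf]; rfl
    rw [h3] at h2
    omega

end

/-- For n = 8: every element of an admissible set `T` on `Fin 8` restricts on
coordinates `{1,2,5,6}` (1-indexed) to none of `(+,−,−,+)`, `(−,+,+,−)`,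
`(+,−,+,−)`, `(−,+,−,+)`. -/
theorem restriction_n8 (T : Finset (Fin 8 → ℤ))
    (hneg : ∀ v ∈ T, -v ∈ T)
    (hcard : T.card = 58)
    (hlower : ∀ v ∈ S2 8, v ∈ T)
    (hupper : ∀ v ∈ T, IsSignVec v ∧ signChanges v ≤ 3)
    (hvc : VCCondition T) :
    ∀ t ∈ T,
      ¬ (t 0 = 1 ∧ t 1 = -1 ∧ t 4 = -1 ∧ t 5 = 1) ∧
      ¬ (t 0 = -1 ∧ t 1 = 1 ∧ t 4 = 1 ∧ t 5 = -1) ∧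
      ¬ (t 0 = 1 ∧ t 1 = -1 ∧ t 4 = 1 ∧ t 5 = -1) ∧
      ¬ (t 0 = -1 ∧ t 1 = 1 ∧ t 4 = -1 ∧ t 5 = 1) := by
  have hfirst : IsMaximalSix (T.image (· ∘ ![0, 1, 2, 3, 4, 5])) :=
    isMaximalSix_image hcard hlower hupper hvc 7 6 (by decide) (by decide +kernel)
      (by decide +kernel)
  have hlast : IsMaximalSix (T.image (· ∘ ![0, 1, 4, 5, 6, 7])) :=
    isMaximalSix_image hcard hlower hupper hvc 3 2 (by decide) (by decide +kernel)
      (by decide +kernel)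
  have houter : ∀ t ∈ T, ¬ (t 0 = 1 ∧ t 1 = -1 ∧ t 4 = -1 ∧ t 5 = 1) := fun t ht =>
    hfirst.avoids_outer (Finset.mem_image_of_mem _ ht)
  have halt : ∀ t ∈ T, ¬ (t 0 = 1 ∧ t 1 = -1 ∧ t 4 = 1 ∧ t 5 = -1) := fun t ht =>
    hlast.avoids_alternating (Finset.mem_image_of_mem _ ht)
  intro t ht
  refine ⟨houter t ht, fun h => houter (-t) (hneg t ht) ?_, halt t ht,
    fun h => halt (-t) (hneg t ht) ?_⟩ <;> simp [h]
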